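/- Let C be a well-powered category with pullbacks, images, coproducts, and an initial object all of whose initial morphisms are monomorphisms (InitialMonoClass). Let B be an object, a = (r, i, i₀, p) a reaction over B, t a subobject of B, and f : B ⟶ B' a monomorphism. Then a is enabled on t if and only if the image reaction f(a) = (map f r, map f i, map f i₀, map f p) is enabled on map f t; that is, (r ≤ t ∧ t ⊓ i ≤ i₀) ↔ ((Subobject.map f) r ≤ (Subobject.map f) t ∧ (Subobject.map f) t ⊓ (Subobject.map f) i ≤ (Subobject.map f) i₀). -/

import Mathlib

open CategoryTheory CategoryTheory.Limits

universe v u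

/-- A reaction over a background object `B`: reactant `r`, inhibitor pair `(i, i₀)`,
and product `p`, all subobjects of `B`. -/
structure Reaction {C : Type u} [Category.{v} C] (B : C) where
  r : Subobject B
  i : Subobject B
  i₀ : Subobject B
  p : Subobject B

/-- A reaction `a` is enabled on a state `t` iff `r ≤ t` and `t ⊓ i ≤ i₀`. -/
def Reaction.enabled {C : Type u} [Category.{v} C] [HasPullbacks C] {B : C}
    (a : Reaction B) (t : Subobject B) : Prop :=
  a.r ≤ t ∧ t ⊓ a.i ≤ a.i₀

/-- The image reaction `f(a)` of a reaction `a` along a monomorphism `f` on the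
background. -/
def Reaction.map {C : Type u} [Category.{v} C] {B B' : C}
    (f : B ⟶ B') [Mono f] (a : Reaction B) : Reaction B' :=
  ⟨(Subobject.map f).obj a.r, (Subobject.map f).obj a.i,
    (Subobject.map f).obj a.i₀, (Subobject.map f).obj a.p⟩

/-- Taking images of subobjects along a monomorphism reflects and preserves the order. -/
theorem CategoryTheory.Subobject.map_obj_le_map_obj_iff
    {C : Type u} [Category.{v} C] [HasPullbacks C] {X Y : C} (f : X ⟶ Y) [Mono f]
    (x y : Subobject X) :
    (Subobject.map f).obj x ≤ (Subobject.map f).obj y ↔ x ≤ y := by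
  refine ⟨fun h => ?_, fun h => (Subobject.map f).monotone h⟩
  simpa only [Subobject.pullback_map_self] using (Subobject.pullback f).monotone h

/-- Theorem 5.1.1: a reaction `a` is enabled on a state `t` iff the image reaction
`f(a)` is enabled on `f ∘ t`, for a monomorphism `f` on the background. -/
theorem reaction_enabled_iff_map_enabled
    {C : Type u} [Category.{v} C] [WellPowered.{v} C]
    [HasPullbacks C] [HasImages C] [HasCoproducts.{v} C]
    [HasInitial C] [InitialMonoClass C]
    {B B' : C} (f : B ⟶ B') [Mono f] (a : Reaction B) (t : Subobject B) :
    a.enabled t ↔ (a.map f).enabled ((Subobject.map f).obj t) := by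
  simp only [Reaction.enabled, Reaction.map, ← Subobject.inf_map,
    Subobject.map_obj_le_map_obj_iff]
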